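/- Let (fᵢ) be a sequence of expanding maps generating full shifts with bounded distortion satisfying condition (ii) (existence of frequency vectors of dimension arbitrarily close to 1 differing in any chosen coordinate). Then the set of x ∈ [0,1) such that for every i, every m, and every word w of length m, the limit lim_{n→∞} τ^{fᵢ}_w(x,n)/(n−m) does not exist, has Hausdorff dimension 1. -/

import Mathlib

open Set MeasureTheory Filter
open scoped ENNReal Classical

noncomputable section

/-- A similarity transformation of `ℝ`. -/
def IsSimilarity (f : ℝ → ℝ) : Prop := ∃ a b : ℝ, a ≠ 0 ∧ ∀ x, f x = a * x + b

/-- Falconer's class `𝒢^s`: Gδ sets all of whose images under countably many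
similarities intersect in a set of Hausdorff dimension at least `s`. -/
def falconerClass (s : ℝ) : Set (Set ℝ) :=
  {F | IsGδ F ∧ ∀ T : ℕ → ℝ → ℝ, (∀ i, IsSimilarity (T i)) →
    ENNReal.ofReal s ≤ dimH (⋂ i, T i '' F)}

/-- A probability vector indexed by a finite type. -/
def IsProbVector {ι : Type*} [Fintype ι] (p : ι → ℝ) : Prop :=
  (∀ i, 0 ≤ p i) ∧ ∑ i, p i = 1

/-- A dyadic half-open interval `[2^k m, 2^k (m+1))`. -/
def IsDyadic (I : Set ℝ) : Prop :=
  ∃ (k m : ℤ), I = Ico ((2:ℝ) ^ k * m) ((2:ℝ) ^ k * (m + 1))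

/-- The outer measure `M^s_∞` obtained from countable covers by dyadic intervals. -/
def dyadicMeasure (s : ℝ) (A : Set ℝ) : ℝ≥0∞ :=
  ⨅ (I : ℕ → Set ℝ) (_ : ∀ i, IsDyadic (I i)) (_ : A ⊆ ⋃ i, I i),
    ∑' i, volume (I i) ^ s

/-- Extension of a subset of `[0,1)` to `ℝ` by integer translations. -/
def periodize (A : Set ℝ) : Set ℝ := ⋃ k : ℤ, (fun x => x + (k : ℝ)) '' A

/-- An expanding interval map on `[0,1)` with `g` full monotone branches,
generating a full shift on `g` symbols. -/
structure ExpandingFullShift where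
  g : ℕ
  one_lt_g : 1 < g
  branch : Fin g → Set ℝ
  branch_Ico : ∀ i, ∃ a b : ℝ, a < b ∧ branch i = Ico a b
  branch_cover : (⋃ i, branch i) = Ico (0:ℝ) 1
  branch_disjoint : ∀ i j, i ≠ j → Disjoint (branch i) (branch j)
  f : ℝ → ℝ
  f_onto : ∀ i, f '' branch i = Ico (0:ℝ) 1
  f_mono : ∀ i, StrictMonoOn f (branch i) ∨ StrictAntiOn f (branch i)
  f_expanding : ∀ i, ∀ x ∈ branch i, ∀ y ∈ branch i, |x - y| ≤ |f x - f y|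

namespace ExpandingFullShift

variable (E : ExpandingFullShift)

/-- The symbol `0`. -/
def zeroSym : Fin E.g := ⟨0, Nat.lt_trans Nat.one_pos E.one_lt_g⟩

/-- The cylinder `C_{x₁ … x_n} ⊆ [0,1)` determined by a word `w`. -/
def cylinder (w : List (Fin E.g)) : Set ℝ :=
  {x ∈ Ico (0:ℝ) 1 | ∀ k (hk : k < w.length), E.f^[k] x ∈ E.branch (w.get ⟨k, hk⟩)}

/-- A cylinder in some interval `[k, k+1)`, `k ∈ ℤ` (periodic extension of the
cylinder structure to `ℝ`). -/
def IsCylinderZ (C : Set ℝ) : Prop :=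
  ∃ (w : List (Fin E.g)) (k : ℤ), C = (fun x => x + (k : ℝ)) '' E.cylinder w

/-- The outer measure `N^s_∞` obtained from countable covers by cylinders of `E`. -/
def cylMeasure (s : ℝ) (A : Set ℝ) : ℝ≥0∞ :=
  ⨅ (c : ℕ → List (Fin E.g)) (_ : A ⊆ ⋃ i, E.cylinder (c i)),
    ∑' i, volume (E.cylinder (c i)) ^ s

/-- The outer measure `N^s_∞` from covers by cylinders of the periodic extension. -/
def cylMeasureZ (s : ℝ) (A : Set ℝ) : ℝ≥0∞ :=
  ⨅ (c : ℕ → Set ℝ) (_ : ∀ i, E.IsCylinderZ (c i)) (_ : A ⊆ ⋃ i, c i),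
    ∑' i, volume (c i) ^ s

/-- The empirical frequency `τ^f_w(x,n)/(n-m)` of the word `w` (of length `m`)
in the first `n` symbols of the expansion of `x`. -/
def freq {m : ℕ} (w : Fin m → Fin E.g) (x : ℝ) (n : ℕ) : ℝ :=
  (((Finset.range (n - m)).filter
      (fun i => ∀ k : Fin m, E.f^[i + k] x ∈ E.branch (w k))).card : ℝ) / ((n - m : ℕ) : ℝ)

/-- `G^{f,m}_{p̄}`: the set of points whose length-`m` word frequencies converge to `p̄`. -/
def Gset (m : ℕ) (p : (Fin m → Fin E.g) → ℝ) : Set ℝ :=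
  {x ∈ Ico (0:ℝ) 1 | ∀ w : Fin m → Fin E.g,
    Tendsto (fun n => E.freq w x n) atTop (nhds (p w))}

/-- `G^{f,m}_{p̄}(n,ε)`: points whose empirical length-`m` word frequencies at time `n`
are within `ε` of `p̄` componentwise. -/
def GsetApprox (m : ℕ) (p : (Fin m → Fin E.g) → ℝ) (n : ℕ) (ε : ℝ) : Set ℝ :=
  {x ∈ Ico (0:ℝ) 1 | ∀ w : Fin m → Fin E.g, |E.freq w x n - p w| < ε}

/-- `p̄ ∈ A^{f,m}(x)`: the vector `p̄` is an accumulation point of the empirical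
frequency vectors of `x` as `n → ∞`. -/
def IsFreqAccum (m : ℕ) (p : (Fin m → Fin E.g) → ℝ) (x : ℝ) : Prop :=
  MapClusterPt p atTop (fun n => fun w => E.freq w x n)

/-- `x` is `m`-normal to `f`: every length-`m` word occurs with frequency equal to
the length of the corresponding cylinder. -/
def IsNormal (m : ℕ) (x : ℝ) : Prop :=
  ∀ w : Fin m → Fin E.g,
    Tendsto (fun n => E.freq w x n) atTop (nhds (volume (E.cylinder (List.ofFn w))).toReal)

/-- Bounded distortion with constant `K`:
`|C_u||C_v|/K ≤ |C_{uv}| ≤ K |C_u||C_v|` for all words `u, v`. -/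
def HasBoundedDistortion (K : ℝ) : Prop :=
  ∀ u v : List (Fin E.g),
    volume (E.cylinder (u ++ v)) ≤
      ENNReal.ofReal K * (volume (E.cylinder u) * volume (E.cylinder v)) ∧
    volume (E.cylinder u) * volume (E.cylinder v) ≤
      ENNReal.ofReal K * volume (E.cylinder (u ++ v))

/-- Condition (ii): for each `m` there is `p̄` with `dim_H G^{f,m}_{p̄} = 1`, and for
each word `w` of length `m` there are vectors `q̄` with `q_w ≠ p_w` whose `G`-set has
Hausdorff dimension arbitrarily close to `1`. -/
def CondII : Prop :=
  ∀ m : ℕ, 0 < m → ∃ p : (Fin m → Fin E.g) → ℝ, IsProbVector p ∧ dimH (E.Gset m p) = 1 ∧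
    ∀ w : Fin m → Fin E.g, ∀ t : ℝ≥0∞, t < 1 → ∃ q : (Fin m → Fin E.g) → ℝ,
      IsProbVector q ∧ q w ≠ p w ∧ t ≤ dimH (E.Gset m q)

end ExpandingFullShift

theorem ENNReal.rpow_le_rpow_of_exponent_nonpos {a b : ℝ≥0∞} (h : a ≤ b) {z : ℝ} (hz : z ≤ 0) :
    b ^ z ≤ a ^ z := by
  have := ENNReal.inv_le_inv.2 (ENNReal.rpow_le_rpow h (neg_nonneg.2 hz))
  rwa [ENNReal.rpow_neg, ENNReal.rpow_neg, inv_inv, inv_inv] at this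

/-- A set `V` is `s`-fat if `[0,1)` can be cut into arbitrarily short intervals, each carrying a
measure of mass its length, concentrated on the interior of `V`, with bounded density, and
satisfying a scale-invariant `s`-Hölder bound. -/
def IsFat (s : ℝ) (V : Set ℝ) : Prop :=
  ∃ C : ℝ≥0∞, C ≠ ∞ ∧ ∀ δ : ℝ≥0∞, 0 < δ → ∃ (ι : Type) (_ : Fintype ι) (I : ι → Set ℝ),
    (∀ i, (I i).OrdConnected) ∧ Pairwise (Function.onFun Disjoint I) ∧ (⋃ i, I i) = Ico 0 1 ∧
    (∀ i, volume (I i) ≤ δ ∧ volume (I i) ≠ 0) ∧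
    ∀ i, ∃ (ν : Measure ℝ) (D : ℝ≥0∞), D ≠ ∞ ∧ ν ≤ D • volume ∧ ν (interior V ∩ I i)ᶜ = 0 ∧
      ν univ = volume (I i) ∧
      ∀ x y, ν (Ico x y) ≤ C * volume (I i) ^ (1 - s) * ENNReal.ofReal (y - x) ^ s

/-- An open set carrying a measure of mass more than `1/2`, with bounded density and an
`s`-Hölder bound with constant less than `2`. -/
def IsFrostmanOpen (s : ℝ) (U : Set ℝ) : Prop :=
  IsOpen U ∧ U ⊆ Ioo 0 1 ∧ ∃ (μ : Measure ℝ) (D a : ℝ≥0∞), D ≠ ∞ ∧ a < 2 ∧ μ ≤ D • volume ∧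
    μ Uᶜ = 0 ∧ 1 / 2 < μ U ∧ ∀ x y, μ (Ico x y) ≤ a * ENNReal.ofReal (y - x) ^ s

theorem edist_le_volume_of_ordConnected {C : Set ℝ} (h : C.OrdConnected) {x y : ℝ}
    (hx : x ∈ C) (hy : y ∈ C) : edist x y ≤ volume C := by
  rw [edist_dist, Real.dist_eq, ← Real.volume_interval]
  exact measure_mono (h.uIcc_subset hy hx)

theorem ediam_le_volume_of_ordConnected {C : Set ℝ} (h : C.OrdConnected) :
    Metric.ediam C ≤ volume C :=
  Metric.ediam_le fun _ hx _ hy => edist_le_volume_of_ordConnected h hx hy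

theorem isFrostmanOpen_Ioo {s : ℝ} (hs : 0 < s) (hs1 : s < 1) : IsFrostmanOpen s (Ioo 0 1) := by
  refine ⟨isOpen_Ioo, Subset.rfl, volume.restrict (Ioo 0 1), 1, 1, by simp, by norm_num, ?_, ?_,
    ?_, fun x y => ?_⟩
  · rw [one_smul]; exact Measure.restrict_le_self
  · rw [Measure.restrict_apply measurableSet_Ioo.compl, compl_inter_self, measure_empty]
  · rw [Measure.restrict_apply_self]; simp
  · rw [one_mul, Measure.restrict_apply measurableSet_Ico]
    have h1 : volume (Ico x y ∩ Ioo 0 1) ≤ 1 :=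
      (measure_mono inter_subset_right).trans (by simp)
    have h2 : volume (Ico x y ∩ Ioo 0 1) ≤ ENNReal.ofReal (y - x) :=
      (measure_mono inter_subset_left).trans (by simp)
    calc volume (Ico x y ∩ Ioo 0 1) = volume (Ico x y ∩ Ioo 0 1) ^ (1 : ℝ) := by simp
      _ ≤ volume (Ico x y ∩ Ioo 0 1) ^ s :=
        ENNReal.rpow_le_rpow_of_exponent_ge h1 hs1.le
      _ ≤ _ := ENNReal.rpow_le_rpow h2 hs.le

theorem sum_measure_Ico_le {ι : Type*} (F : Finset ι) (I : ι → Set ℝ)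
    (hI : ∀ i, (I i).OrdConnected) (hd : Pairwise (Function.onFun Disjoint I)) (μ : Measure ℝ)
    (ν : ι → Measure ℝ) (c : ι → ℝ≥0∞) (hm : ∀ i, c i * ν i univ = μ (I i)) (x y : ℝ) (B : ℝ≥0∞)
    (hB : ∀ i, c i * ν i (Ico x y) ≤ B) (hν : ∀ i, ν i (I i)ᶜ = 0) :
    ∑ i ∈ F, c i * ν i (Ico x y) ≤ μ (Ico x y) + (B + B) := by
  have key : ∀ i, c i * ν i (Ico x y) ≤ (if I i ⊆ Ico x y then μ (I i) else 0) +
      ((if x ∈ I i then B else 0) + (if y ∈ I i then B else 0)) := by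
    intro i
    by_cases h : I i ⊆ Ico x y
    · rw [if_pos h]
      refine le_add_right ?_
      rw [← hm]
      gcongr
      exact subset_univ _
    · rw [if_neg h, zero_add]
      obtain ⟨z, hz, hz'⟩ := not_subset.1 h
      by_cases h' : (Ico x y ∩ I i).Nonempty
      · obtain ⟨u, ⟨hu1, hu2⟩, hu⟩ := h'
        by_cases hzx : z < x
        · rw [if_pos ((hI i).out hz hu ⟨hzx.le, hu1⟩)]
          exact le_add_right (hB i)
        · have : y ≤ z := by
            by_contra hc
            exact hz' ⟨not_lt.1 hzx, not_le.1 hc⟩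
          rw [if_pos ((hI i).out hu hz ⟨hu2.le, this⟩)]
          exact le_add_left (hB i)
      · have : ν i (Ico x y) = 0 :=
          measure_mono_null (fun u hu hui => h' ⟨u, hu, hui⟩) (hν i)
        simp [this]
  have one : ∀ z : ℝ, ∑ i ∈ F, (if z ∈ I i then B else 0) ≤ B := by
    intro z
    by_cases hz : ∃ i ∈ F, z ∈ I i
    · obtain ⟨i, hi, hzi⟩ := hz
      rw [Finset.sum_eq_single i]
      · simp [hzi]
      · intro j _ hj
        rw [if_neg]
        exact fun hzj => (disjoint_left.1 (hd hj) hzj) hzi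
      · exact fun h => absurd hi h
    · push Not at hz
      rw [Finset.sum_eq_zero]
      · exact zero_le
      · intro i hi
        rw [if_neg (hz i hi)]
  refine (Finset.sum_le_sum fun i _ => key i).trans ?_
  rw [Finset.sum_add_distrib, Finset.sum_add_distrib]
  refine add_le_add ?_ (add_le_add (one x) (one y))
  rw [← Finset.sum_filter, ← measure_biUnion_finset (fun i _ j _ hij => hd hij)
    (fun i _ => (hI i).measurableSet)]
  refine measure_mono ?_
  simp only [iUnion_subset_iff, Finset.mem_filter]
  exact fun i hi => hi.2

theorem IsFrostmanOpen.exists_closure_subset_inter {s : ℝ} (hs1 : s < 1) {U V : Set ℝ}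
    (hU : IsFrostmanOpen s U) (hV : IsFat s V) :
    ∃ U', IsFrostmanOpen s U' ∧ closure U' ⊆ U ∩ V := by
  obtain ⟨hUo, hU01, μ, D, a, hD, ha, hμD, hμU, hμ2, hμ⟩ := hU
  obtain ⟨C, hC, hV⟩ := hV
  have hfin : IsFiniteMeasure μ := by
    refine ⟨?_⟩
    have h1 : μ univ ≤ μ U + μ Uᶜ := by
      rw [← union_compl_self U]; exact measure_union_le _ _
    have h2 : μ U ≤ D := by
      refine (hμD U).trans ?_
      rw [Measure.smul_apply, smul_eq_mul]
      calc D * volume U ≤ D * volume (Ioo (0 : ℝ) 1) := by gcongr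
        _ = D := by simp
    rw [hμU, add_zero] at h1
    exact (h1.trans h2).trans_lt hD.lt_top
  obtain ⟨K, hKU, hK, hμK⟩ := hUo.exists_lt_isCompact hμ2
  obtain ⟨r, hr, hrU⟩ := hK.exists_thickening_subset_open hUo hKU
  set e : ℝ≥0∞ := ((2 - a) / 2) / (2 * (D * C) + 1) with he
  have hDC : 2 * (D * C) + 1 ≠ ∞ := by finiteness
  have he0 : e ≠ 0 := by
    rw [he]
    refine (ENNReal.div_pos (ENNReal.div_pos (tsub_pos_of_lt ha).ne' (by simp)).ne' hDC).ne'
  set δ : ℝ≥0∞ := min (ENNReal.ofReal (r / 2)) (e ^ (1 / (1 - s))) with hδ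
  have hδ0 : 0 < δ := by
    refine lt_min (by simpa using hr) ?_
    refine ENNReal.rpow_pos_of_nonneg (pos_iff_ne_zero.2 he0) ?_
    exact one_div_nonneg.2 (by linarith)
  have hδe : δ ^ (1 - s) ≤ e := by
    calc δ ^ (1 - s) ≤ (e ^ (1 / (1 - s))) ^ (1 - s) :=
          ENNReal.rpow_le_rpow (min_le_right _ _) (by linarith)
      _ = e := by
          rw [← ENNReal.rpow_mul, one_div, inv_mul_cancel₀ (by linarith), ENNReal.rpow_one]
  obtain ⟨ι, _, I, hI, hd, hcov, hvol, hν⟩ := hV δ hδ0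
  choose ν N hN hνN hνc hνm hνH using hν
  have hvfin : ∀ i, volume (I i) ≠ ∞ := fun i => by
    refine (measure_mono (t := Ico (0 : ℝ) 1) ?_).trans_lt (by simp) |>.ne
    rw [← hcov]; exact subset_iUnion _ _
  set c : ι → ℝ≥0∞ := fun i => μ (I i) / volume (I i) with hc
  have hcD : ∀ i, c i ≤ D := fun i => ENNReal.div_le_of_le_mul (hμD (I i))
  have hcm : ∀ i, c i * ν i univ = μ (I i) := fun i => by
    rw [hνm, hc]; exact ENNReal.div_mul_cancel (hvol i).2 (hvfin i)
  have hνI : ∀ i, ν i (I i)ᶜ = 0 := fun i =>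
    measure_mono_null (compl_subset_compl.2 inter_subset_right) (hνc i)
  let F : Finset ι := Finset.univ.filter fun i => (I i ∩ K).Nonempty
  have hFU : ∀ i ∈ F, I i ⊆ U := by
    intro i hi y hy
    obtain ⟨z, hz, hzK⟩ := (Finset.mem_filter.1 hi).2
    refine hrU (Metric.mem_thickening_iff.2 ⟨z, hzK, ?_⟩)
    have h1 := ((edist_le_volume_of_ordConnected (hI i) hy hz).trans (hvol i).1).trans
      (min_le_left _ _)
    rw [edist_dist, ENNReal.ofReal_le_ofReal_iff (by positivity)] at h1
    linarith
  let μ' : Measure ℝ := ∑ i ∈ F, c i • ν i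
  have hμ'a : ∀ A, μ' A = ∑ i ∈ F, c i * ν i A := by
    intro A
    simp [μ', Measure.finsetSum_apply]
  set O := U ∩ interior V with hO
  have hOo : IsOpen O := hUo.inter isOpen_interior
  have hμ'O : μ' Oᶜ = 0 := by
    rw [hμ'a]
    refine Finset.sum_eq_zero fun i hi => ?_
    rw [measure_mono_null (compl_subset_compl.2 _) (hνc i), mul_zero]
    exact fun z hz => ⟨hFU i hi hz.2, hz.1⟩
  have hμ'2 : 1 / 2 < μ' O := by
    have h1 : μ' univ ≤ μ' O := by
      calc μ' univ ≤ μ' O + μ' Oᶜ := by rw [← union_compl_self O]; exact measure_union_le _ _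
        _ = μ' O := by rw [hμ'O, add_zero]
    refine (hμK.trans_le ?_).trans_le h1
    rw [hμ'a, Finset.sum_congr rfl fun i _ => hcm i]
    refine (measure_mono fun z hz => ?_).trans (measure_biUnion_finset_le F I)
    have hz01 : z ∈ ⋃ i, I i := by
      rw [hcov]; exact Ioo_subset_Ico_self (hU01 (hKU hz))
    obtain ⟨i, hi⟩ := mem_iUnion.1 hz01
    exact mem_biUnion (Finset.mem_coe.2 (Finset.mem_filter.2 ⟨Finset.mem_univ i, ⟨z, hi, hz⟩⟩)) hi
  have hμ'D : μ' ≤ (D * ∑ i, N i) • volume := by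
    refine Measure.le_iff'.2 fun A => ?_
    rw [hμ'a, Measure.smul_apply, smul_eq_mul, mul_assoc, Finset.sum_mul, Finset.mul_sum]
    refine (Finset.sum_le_sum_of_subset (Finset.subset_univ F)).trans ?_
    refine Finset.sum_le_sum fun i _ => mul_le_mul' (hcD i) ?_
    simpa using hνN i A
  have hND : D * ∑ i, N i ≠ ∞ :=
    ENNReal.mul_ne_top hD (ENNReal.sum_ne_top.2 fun i _ => hN i)
  have hμ'fin : IsFiniteMeasure μ' := by
    refine ⟨?_⟩
    rw [hμ'a, Finset.sum_congr rfl fun i _ => hcm i]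
    exact ENNReal.sum_lt_top.2 fun i _ => measure_lt_top μ _
  have hμ'H : ∀ x y, μ' (Ico x y) ≤ (a + (2 - a) / 2) * ENNReal.ofReal (y - x) ^ s := by
    intro x y
    set R := ENNReal.ofReal (y - x) ^ s
    rw [hμ'a]
    refine (sum_measure_Ico_le F I hI hd μ ν c hcm x y (D * C * e * R) (fun i => ?_) hνI).trans ?_
    · calc c i * ν i (Ico x y) ≤ D * (C * volume (I i) ^ (1 - s) * R) :=
            mul_le_mul' (hcD i) (hνH i x y)
        _ ≤ D * (C * e * R) := by
            gcongr
            exact (ENNReal.rpow_le_rpow (hvol i).1 (by linarith)).trans hδe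
        _ = D * C * e * R := by ring
    · rw [add_mul]
      refine add_le_add (hμ x y) ?_
      calc D * C * e * R + D * C * e * R = (2 * (D * C)) * e * R := by ring
        _ ≤ (2 * (D * C) + 1) * e * R := by gcongr; exact le_self_add
        _ ≤ (2 - a) / 2 * R := by
            gcongr
            exact ENNReal.mul_div_le
  have ha' : a + (2 - a) / 2 < 2 := by
    have h2a : (2 - a) ≠ 0 := (tsub_pos_of_lt ha).ne'
    calc a + (2 - a) / 2 < a + (2 - a) := by
          refine ENNReal.add_lt_add_left ha.ne_top (ENNReal.half_lt_self h2a ?_)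
          exact (tsub_le_self.trans_lt (by simp)).ne
      _ = 2 := add_tsub_cancel_of_le ha.le
  obtain ⟨K₁, hK₁O, hK₁, hμ'K₁⟩ := hOo.exists_lt_isCompact hμ'2
  obtain ⟨K₂, hK₂, hK₁₂, hK₂O⟩ := exists_compact_between hK₁ hOo hK₁O
  refine ⟨interior K₂, ⟨isOpen_interior, ?_, μ'.restrict (interior K₂), D * ∑ i, N i,
    a + (2 - a) / 2, hND, ha', Measure.restrict_le_self.trans hμ'D, ?_, ?_, fun x y => ?_⟩, ?_⟩
  · exact (interior_subset.trans hK₂O).trans (inter_subset_left.trans hU01)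
  · rw [Measure.restrict_apply isOpen_interior.measurableSet.compl, compl_inter_self,
      measure_empty]
  · rw [Measure.restrict_apply_self]
    exact hμ'K₁.trans_le (measure_mono hK₁₂)
  · exact (Measure.restrict_apply_le _ _).trans (hμ'H x y)
  · exact (closure_minimal interior_subset hK₂.isClosed).trans
      (hK₂O.trans (inter_subset_inter_right _ interior_subset))

theorem exists_cover_of_hausdorffMeasure_eq_zero {s : ℝ} (hs : 0 < s) {A : Set ℝ}
    (h : μH[s] A = 0) {η : ℝ≥0∞} (hη : 0 < η) :
    ∃ t : ℕ → Set ℝ, A ⊆ ⋃ n, t n ∧ ∑' n, Metric.ediam (t n) ^ s < η := by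
  rw [Measure.hausdorffMeasure_apply] at h
  have h1 := ENNReal.iSup_eq_zero.1 (ENNReal.iSup_eq_zero.1 h 1) one_pos
  have h2 := h1.trans_lt hη
  simp only [iInf_lt_iff] at h2
  obtain ⟨t, ht, -, hlt⟩ := h2
  refine ⟨t, ht, (ENNReal.tsum_le_tsum fun n => ?_).trans_lt hlt⟩
  rcases (t n).eq_empty_or_nonempty with h0 | h0
  · simp [h0, hs]
  · rw [iSup_pos h0]

theorem hausdorffMeasure_eq_zero_of_forall_cover {s : ℝ} (hs : 0 < s) {A : Set ℝ}
    (h : ∀ η : ℝ≥0∞, 0 < η → ∃ t : ℕ → Set ℝ, A ⊆ ⋃ n, t n ∧ ∑' n, Metric.ediam (t n) ^ s < η) :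
    μH[s] A = 0 := by
  rw [Measure.hausdorffMeasure_apply]
  refine ENNReal.iSup_eq_zero.2 fun r => ENNReal.iSup_eq_zero.2 fun hr => ?_
  refine le_antisymm (le_of_forall_gt fun η hη => ?_) zero_le
  have hrs : 0 < r ^ s := by
    rcases eq_or_ne r ∞ with rfl | hr'
    · simp [hs]
    · exact ENNReal.rpow_pos hr hr'
  obtain ⟨t, ht, hlt⟩ := h (min η (r ^ s)) (lt_min hη hrs)
  simp only [iInf_lt_iff]
  refine ⟨t, ht, fun n => ?_, (ENNReal.tsum_le_tsum fun n => ?_).trans_lt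
    (hlt.trans_le (min_le_left _ _))⟩
  · exact (ENNReal.rpow_le_rpow_iff hs).1
      ((ENNReal.le_tsum n).trans (hlt.le.trans (min_le_right _ _)))
  · exact iSup_le fun _ => le_rfl

theorem exists_subset_Ioo_of_ediam {s : ℝ} (hs : 0 < s) (hs1 : s ≤ 1) (t : Set ℝ)
    (ht : Metric.ediam t ≠ ∞) {η : ℝ≥0∞} (hη : 0 < η) :
    ∃ x y : ℝ, t ⊆ Ioo x y ∧
      ENNReal.ofReal (y - x) ^ s ≤ (2 : ℝ≥0∞) ^ s * Metric.ediam t ^ s + η := by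
  rcases t.eq_empty_or_nonempty with rfl | ⟨x, hx⟩
  · exact ⟨0, 0, by simp, by simp [hs]⟩
  obtain ⟨e, he0, he⟩ : ∃ e : ℝ, 0 < e ∧ ENNReal.ofReal (2 * e) ^ s ≤ η := by
    obtain ⟨b, hb0, hb⟩ := ENNReal.lt_iff_exists_nnreal_btwn.1 hη
    have hb0 : 0 < b := by exact_mod_cast hb0
    refine ⟨(b : ℝ) ^ (1 / s) / 2, by positivity, ?_⟩
    rw [mul_div_cancel₀ _ two_ne_zero, ENNReal.ofReal_rpow_of_pos (by positivity),
      ← Real.rpow_mul (by positivity), one_div, inv_mul_cancel₀ hs.ne', Real.rpow_one,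
      ENNReal.ofReal_coe_nnreal]
    exact hb.le
  set d := (Metric.ediam t).toReal with hd
  have hd' : ENNReal.ofReal d = Metric.ediam t := ENNReal.ofReal_toReal ht
  have hd0 : 0 ≤ d := ENNReal.toReal_nonneg
  refine ⟨x - d - e, x + d + e, fun y hy => ?_, ?_⟩
  · have h1 := Metric.edist_le_ediam_of_mem hx hy
    rw [← hd', edist_dist, ENNReal.ofReal_le_ofReal_iff hd0, Real.dist_eq, abs_le] at h1
    exact ⟨by linarith, by linarith⟩
  · calc ENNReal.ofReal (x + d + e - (x - d - e)) ^ s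
        = (2 * ENNReal.ofReal d + ENNReal.ofReal (2 * e)) ^ s := by
          rw [show x + d + e - (x - d - e) = 2 * d + 2 * e by ring,
            ENNReal.ofReal_add (by positivity) (by positivity), ENNReal.ofReal_mul zero_le_two]
          simp
      _ ≤ (2 * ENNReal.ofReal d) ^ s + ENNReal.ofReal (2 * e) ^ s :=
          ENNReal.rpow_add_le_add_rpow _ _ hs.le hs1
      _ ≤ _ := by
          rw [ENNReal.mul_rpow_of_nonneg _ _ hs.le, hd']
          gcongr

theorem le_dimH_iInter_of_isFat {s : NNReal} (hs : 0 < s) (hs1 : s < 1) (V : ℕ → Set ℝ)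
    (hV : ∀ n, IsFat s (V n)) : (s : ℝ≥0∞) ≤ dimH (Ico 0 1 ∩ ⋂ n, V n) := by
  have hs' : (0 : ℝ) < s := by exact_mod_cast hs
  have hs1' : (s : ℝ) < 1 := by exact_mod_cast hs1
  choose! nxt hnxt hnxt' using fun (n : ℕ) (U : Set ℝ) (hU : IsFrostmanOpen s U) =>
    hU.exists_closure_subset_inter hs1' (hV n)
  let U : ℕ → Set ℝ := fun n => Nat.rec (Ioo 0 1) (fun k W => nxt k W) n
  have hU : ∀ n, IsFrostmanOpen s (U n) := by
    intro n
    induction n with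
    | zero => exact isFrostmanOpen_Ioo hs' hs1'
    | succ k ih => exact hnxt k _ ih
  have hUc : ∀ n, closure (U (n + 1)) ⊆ U n ∩ V n := fun n => hnxt' n _ (hU n)
  set A := ⋂ n, closure (U n) with hA
  have hAs : A ⊆ Ico 0 1 ∩ ⋂ n, V n := by
    intro x hx
    have hx' := fun n => hUc n (mem_iInter.1 hx (n + 1))
    exact ⟨Ioo_subset_Ico_self ((hU 0).2.1 (hx' 0).1), mem_iInter.2 fun n => (hx' n).2⟩
  refine le_trans (le_dimH_of_hausdorffMeasure_ne_zero fun h0 => ?_) (dimH_mono hAs)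
  obtain ⟨t, htA, ht⟩ := exists_cover_of_hausdorffMeasure_eq_zero hs' h0
    (η := 1 / 16) (by simp)
  have htfin : ∀ n, Metric.ediam (t n) ≠ ∞ := fun n hn => by
    have h1 := (ENNReal.le_tsum (f := fun n => Metric.ediam (t n) ^ (s : ℝ)) n).trans ht.le
    simp [hn, hs'] at h1
  obtain ⟨ε, hε0, hε⟩ := ENNReal.exists_pos_sum_of_countable
    (ε := 1 / 16) (by simp) ℕ
  choose x y hxy hlen using fun n =>
    exists_subset_Ioo_of_ediam hs' hs1'.le (t n) (htfin n) (η := ε n) (by simpa using hε0 n)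
  have hanti : Antitone fun n => closure (U n) := antitone_nat_of_succ_le fun n =>
    (hUc n).trans (inter_subset_left.trans subset_closure)
  obtain ⟨n, hn⟩ := exists_subset_nhds_of_isCompact' (V := fun n => closure (U n))
    (U := ⋃ n, Ioo (x n) (y n))
    (directed_of_isDirected_le hanti)
    (fun n => (isCompact_Icc (a := (0 : ℝ)) (b := 1)).of_isClosed_subset isClosed_closure
      (closure_minimal ((hU n).2.1.trans Ioo_subset_Icc_self) isClosed_Icc))
    (fun n => isClosed_closure)
    (fun z hz => (isOpen_iUnion fun n => isOpen_Ioo).mem_nhds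
      ((htA.trans (iUnion_mono hxy)) hz))
  obtain ⟨-, -, μ, D, a, -, ha, -, -, hμ2, hμ⟩ := hU n
  have htwo : (2 : ℝ≥0∞) ^ (s : ℝ) ≤ 2 := by
    calc (2 : ℝ≥0∞) ^ (s : ℝ) ≤ 2 ^ (1 : ℝ) :=
          ENNReal.rpow_le_rpow_of_exponent_le (by norm_num) hs1'.le
      _ = 2 := by simp
  have hfinal : μ (U n) ≤ 2 * (2 * (1 / 16) + 1 / 16) := by
    calc μ (U n) ≤ μ (⋃ n, Ico (x n) (y n)) :=
          measure_mono (subset_closure.trans (hn.trans (iUnion_mono fun n => Ioo_subset_Ico_self)))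
      _ ≤ ∑' n, μ (Ico (x n) (y n)) := measure_iUnion_le _
      _ ≤ ∑' n, 2 * (2 * Metric.ediam (t n) ^ (s : ℝ) + ε n) := by
          refine ENNReal.tsum_le_tsum fun k => (hμ _ _).trans ?_
          refine mul_le_mul' ha.le ((hlen k).trans ?_)
          gcongr
      _ = 2 * (2 * ∑' n, Metric.ediam (t n) ^ (s : ℝ) + ∑' n, (ε n : ℝ≥0∞)) := by
          rw [ENNReal.tsum_mul_left, ENNReal.tsum_add, ENNReal.tsum_mul_left]
      _ ≤ _ := by gcongr
  refine absurd (hμ2.trans_le hfinal) (not_lt.2 ?_)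
  rw [← ENNReal.toReal_le_toReal (by finiteness) (by finiteness)]
  rw [ENNReal.toReal_mul, ENNReal.toReal_add (by finiteness) (by finiteness), ENNReal.toReal_mul]
  norm_num

namespace ExpandingFullShift

variable {E : ExpandingFullShift}

theorem branch_subset (i : Fin E.g) : E.branch i ⊆ Ico 0 1 := by
  rw [← E.branch_cover]; exact subset_iUnion _ i

theorem exists_mem_branch {x : ℝ} (hx : x ∈ Ico (0 : ℝ) 1) : ∃ i, x ∈ E.branch i := by
  rw [← E.branch_cover] at hx; exact mem_iUnion.1 hx

theorem f_mem_of_mem_branch {i : Fin E.g} {x : ℝ} (hx : x ∈ E.branch i) : E.f x ∈ Ico (0 : ℝ) 1 := by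
  rw [← E.f_onto i]; exact mem_image_of_mem _ hx

theorem f_mem {x : ℝ} (hx : x ∈ Ico (0 : ℝ) 1) : E.f x ∈ Ico (0 : ℝ) 1 := by
  obtain ⟨i, hi⟩ := E.exists_mem_branch hx
  exact f_mem_of_mem_branch hi

theorem cylinder_subset (w : List (Fin E.g)) : E.cylinder w ⊆ Ico 0 1 := fun _ hx => hx.1

theorem cylinder_nil : E.cylinder [] = Ico 0 1 := by
  ext x; simp [cylinder]

theorem mem_cylinder_cons {i : Fin E.g} {v : List (Fin E.g)} {x : ℝ} :
    x ∈ E.cylinder (i :: v) ↔ x ∈ E.branch i ∧ E.f x ∈ E.cylinder v := by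
  constructor
  · rintro ⟨hx, h⟩
    refine ⟨by simpa using h 0 (by simp), E.f_mem hx, fun k hk => ?_⟩
    simpa using h (k + 1) (by simpa using hk)
  · rintro ⟨hx, -, h⟩
    refine ⟨E.branch_subset i hx, fun k hk => ?_⟩
    cases k with
    | zero => simpa using hx
    | succ k => simpa using h k (by simpa using hk)

theorem mem_cylinder_append {u v : List (Fin E.g)} {x : ℝ} :
    x ∈ E.cylinder (u ++ v) ↔ x ∈ E.cylinder u ∧ E.f^[u.length] x ∈ E.cylinder v := by
  induction u generalizing x with
  | nil =>
    simp only [List.nil_append, cylinder_nil, List.length_nil, Function.iterate_zero, id_eq]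
    exact ⟨fun h => ⟨h.1, h⟩, fun h => h.2⟩
  | cons i u ih =>
    rw [List.cons_append, mem_cylinder_cons, mem_cylinder_cons, ih, List.length_cons,
      Function.iterate_succ_apply, and_assoc]

theorem ordConnected_branch_inter_preimage (i : Fin E.g) {A : Set ℝ} (hA : A.OrdConnected) :
    (E.branch i ∩ E.f ⁻¹' A).OrdConnected := by
  obtain ⟨a, b, -, hab⟩ := E.branch_Ico i
  refine ⟨fun x hx y hy z hz => ?_⟩
  have hzi : z ∈ E.branch i := by
    have hxi := hx.1
    have hyi := hy.1
    rw [hab] at hxi hyi ⊢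
    exact ⟨hxi.1.trans hz.1, hz.2.trans_lt hyi.2⟩
  refine ⟨hzi, ?_⟩
  rcases E.f_mono i with h | h
  · exact hA.out hx.2 hy.2 ⟨h.monotoneOn hx.1 hzi hz.1, h.monotoneOn hzi hy.1 hz.2⟩
  · exact hA.out hy.2 hx.2 ⟨h.antitoneOn hzi hy.1 hz.2, h.antitoneOn hx.1 hzi hz.1⟩

theorem cylinder_cons (i : Fin E.g) (v : List (Fin E.g)) :
    E.cylinder (i :: v) = E.branch i ∩ E.f ⁻¹' E.cylinder v :=
  Set.ext fun _ => mem_cylinder_cons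

theorem cylinder_singleton (i : Fin E.g) : E.cylinder [i] = E.branch i := by
  rw [cylinder_cons, cylinder_nil]
  exact inter_eq_left.2 fun _ hx => f_mem_of_mem_branch hx

theorem ordConnected_cylinder (v : List (Fin E.g)) : (E.cylinder v).OrdConnected := by
  induction v with
  | nil => rw [cylinder_nil]; exact ordConnected_Ico
  | cons i v ih => rw [cylinder_cons]; exact ordConnected_branch_inter_preimage i ih

theorem measurableSet_cylinder (v : List (Fin E.g)) : MeasurableSet (E.cylinder v) :=
  (ordConnected_cylinder v).measurableSet

theorem exists_iterate_eq (u : List (Fin E.g)) {y : ℝ} (hy : y ∈ Ico (0 : ℝ) 1) :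
    ∃ x ∈ E.cylinder u, E.f^[u.length] x = y := by
  induction u with
  | nil => exact ⟨y, by rwa [cylinder_nil], rfl⟩
  | cons i u ih =>
    obtain ⟨x, hx, hxy⟩ := ih
    obtain ⟨z, hz, hzx⟩ : x ∈ E.f '' E.branch i := by rw [E.f_onto]; exact hx.1
    refine ⟨z, mem_cylinder_cons.2 ⟨hz, by rwa [hzx]⟩, ?_⟩
    rw [List.length_cons, Function.iterate_succ_apply, hzx, hxy]

theorem disjoint_branch {i j : Fin E.g} {x : ℝ} (hi : x ∈ E.branch i) (hj : x ∈ E.branch j) :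
    i = j := by
  by_contra h
  exact disjoint_left.1 (E.branch_disjoint i j h) hi hj

theorem cylinder_anti {u v : List (Fin E.g)} (h : u <+: v) : E.cylinder v ⊆ E.cylinder u := by
  obtain ⟨t, rfl⟩ := h
  exact fun x hx => (mem_cylinder_append.1 hx).1

theorem prefix_of_mem_of_mem {u v : List (Fin E.g)} {x : ℝ} (hu : x ∈ E.cylinder u)
    (hv : x ∈ E.cylinder v) (h : u.length ≤ v.length) : u <+: v := by
  induction u generalizing v x with
  | nil => exact List.nil_prefix
  | cons i u ih =>
    cases v with
    | nil => simp at h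
    | cons j v =>
      rw [mem_cylinder_cons] at hu hv
      obtain rfl := disjoint_branch hu.1 hv.1
      exact (List.prefix_cons_inj _).2 (ih hu.2 hv.2 (by simpa using h))

theorem prefix_or_prefix_or_disjoint (u v : List (Fin E.g)) :
    u <+: v ∨ v <+: u ∨ Disjoint (E.cylinder u) (E.cylinder v) := by
  by_cases h : Disjoint (E.cylinder u) (E.cylinder v)
  · exact Or.inr (Or.inr h)
  obtain ⟨x, hu, hv⟩ := not_disjoint_iff.1 h
  rcases le_total u.length v.length with h | h
  · exact Or.inl (prefix_of_mem_of_mem hu hv h)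
  · exact Or.inr (Or.inl (prefix_of_mem_of_mem hv hu h))

theorem iUnion_cylinder_append (v : List (Fin E.g)) :
    ⋃ i, E.cylinder (v ++ [i]) = E.cylinder v := by
  refine Subset.antisymm (iUnion_subset fun i => cylinder_anti (List.prefix_append _ _)) ?_
  intro x hx
  have hx' : E.f^[v.length] x ∈ Ico (0 : ℝ) 1 := by
    have := (mem_cylinder_append (u := v) (v := []) (x := x)).1 (by simpa using hx)
    exact this.2.1
  obtain ⟨i, hi⟩ := E.exists_mem_branch hx'
  exact mem_iUnion.2 ⟨i, mem_cylinder_append.2 ⟨hx, by rwa [cylinder_singleton]⟩⟩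

theorem pairwise_disjoint_cylinder_append (v : List (Fin E.g)) :
    Pairwise (Function.onFun Disjoint fun i => E.cylinder (v ++ [i])) := by
  intro i j hij
  refine disjoint_left.2 fun x hi hj => hij ?_
  have h1 := (mem_cylinder_append.1 hi).2
  have h2 := (mem_cylinder_append.1 hj).2
  rw [cylinder_singleton] at h1 h2
  exact disjoint_branch h1 h2

theorem exists_mem_cylinder_ofFn (n : ℕ) {x : ℝ} (hx : x ∈ Ico (0 : ℝ) 1) :
    ∃ w : Fin n → Fin E.g, x ∈ E.cylinder (List.ofFn w) := by
  have hit : ∀ k, E.f^[k] x ∈ Ico (0 : ℝ) 1 := fun k => by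
    induction k with
    | zero => exact hx
    | succ k ih => rw [Function.iterate_succ_apply']; exact E.f_mem ih
  choose a ha using fun k => E.exists_mem_branch (hit k)
  exact ⟨fun k => a k, hx, fun k hk => by simpa using ha k⟩

/-- The length of a cylinder. -/
def len (E : ExpandingFullShift) (v : List (Fin E.g)) : ℝ≥0∞ := volume (E.cylinder v)

theorem len_le_one (v : List (Fin E.g)) : E.len v ≤ 1 :=
  (measure_mono (cylinder_subset v)).trans (by simp)

theorem len_ne_top (v : List (Fin E.g)) : E.len v ≠ ∞ := ((len_le_one v).trans_lt (by simp)).ne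

theorem len_anti {u v : List (Fin E.g)} (h : u <+: v) : E.len v ≤ E.len u :=
  measure_mono (cylinder_anti h)

theorem len_singleton_ne_zero (i : Fin E.g) : E.len [i] ≠ 0 := by
  obtain ⟨a, b, h, hab⟩ := E.branch_Ico i
  rw [len, cylinder_singleton, hab, Real.volume_Ico]
  simpa using h

theorem sum_len_append (v : List (Fin E.g)) : ∑ i, E.len (v ++ [i]) = E.len v := by
  unfold len
  rw [← iUnion_cylinder_append v, measure_iUnion (pairwise_disjoint_cylinder_append v)
    fun i => measurableSet_cylinder _, tsum_fintype]

theorem len_ne_zero {K : ℝ} (hE : E.HasBoundedDistortion K) (v : List (Fin E.g)) :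
    E.len v ≠ 0 := by
  induction v with
  | nil => simp [len, cylinder_nil]
  | cons i v ih =>
    intro h
    have h1 := (hE [i] v).2
    rw [List.singleton_append, show volume (E.cylinder (i :: v)) = 0 from h, mul_zero] at h1
    exact mul_ne_zero (len_singleton_ne_zero i) ih (le_antisymm h1 zero_le)

theorem volume_interior_cylinder (v : List (Fin E.g)) :
    volume (interior (E.cylinder v)) = E.len v := by
  refine le_antisymm (measure_mono interior_subset) ?_
  calc E.len v ≤ volume (interior (E.cylinder v) ∪ frontier (E.cylinder v)) := by
        rw [← closure_eq_interior_union_frontier]; exact measure_mono subset_closure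
    _ ≤ volume (interior (E.cylinder v)) + volume (frontier (E.cylinder v)) :=
        measure_union_le _ _
    _ = _ := by
        rw [Convex.addHaar_frontier volume (ordConnected_cylinder v).convex, add_zero]

theorem exists_mul_len_le {K : ℝ} (hK : 1 ≤ K) (hE : E.HasBoundedDistortion K) :
    ∃ δ : ℝ, 0 < δ ∧ ∀ v i, ENNReal.ofReal δ * E.len v ≤ E.len (v ++ [i]) := by
  have : Nonempty (Fin E.g) := ⟨E.zeroSym⟩
  obtain ⟨i₀, hi₀⟩ := Finite.exists_min fun i => E.len [i]
  have hK0 : ENNReal.ofReal K ≠ 0 := by simp; linarith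
  have hδ : E.len [i₀] / ENNReal.ofReal K ≠ ∞ :=
    ENNReal.div_ne_top (len_ne_top _) hK0
  refine ⟨(E.len [i₀] / ENNReal.ofReal K).toReal, ?_, fun v i => ?_⟩
  · refine ENNReal.toReal_pos (ENNReal.div_pos (len_singleton_ne_zero _) (by simp)).ne' hδ
  · rw [ENNReal.ofReal_toReal hδ, mul_comm, ← mul_div_assoc]
    refine ENNReal.div_le_of_le_mul' ?_
    calc E.len v * E.len [i₀] ≤ E.len v * E.len [i] := by gcongr; exact hi₀ i
      _ ≤ _ := (hE v [i]).2

theorem exists_len_le {K : ℝ} (hK : 1 ≤ K) (hE : E.HasBoundedDistortion K) {ε : ℝ≥0∞}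
    (hε : 0 < ε) : ∃ N, ∀ v : List (Fin E.g), N ≤ v.length → E.len v ≤ ε := by
  obtain ⟨δ, hδ0, hδ⟩ := exists_mul_len_le hK hE
  have hstep : ∀ v i, E.len (v ++ [i]) ≤ (1 - ENNReal.ofReal δ) * E.len v := by
    intro v i
    obtain ⟨j, hj⟩ : ∃ j, j ≠ i := by
      have : Nontrivial (Fin E.g) := Fin.nontrivial_iff_two_le.2 E.one_lt_g
      exact exists_ne i
    have h1 : E.len (v ++ [i]) + E.len (v ++ [j]) ≤ E.len v := by
      rw [← sum_len_append v, ← Finset.sum_pair (f := fun k => E.len (v ++ [k])) hj.symm]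
      exact Finset.sum_le_sum_of_subset (Finset.subset_univ _)
    rw [ENNReal.sub_mul (fun _ _ => len_ne_top v), one_mul]
    refine ENNReal.le_sub_of_add_le_right
      (ENNReal.mul_ne_top ENNReal.ofReal_ne_top (len_ne_top v)) ?_
    refine le_trans ?_ h1
    gcongr
    exact hδ v j
  have hpow : ∀ v : List (Fin E.g), E.len v ≤ (1 - ENNReal.ofReal δ) ^ v.length := by
    intro v
    induction v using List.reverseRecOn with
    | nil => simpa using len_le_one _
    | append_singleton v i ih =>
      refine (hstep v i).trans ?_
      rw [List.length_append, List.length_singleton, pow_succ, mul_comm]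
      gcongr
  have hlt : 1 - ENNReal.ofReal δ < 1 :=
    ENNReal.sub_lt_self (by simp) (by simp) (by simpa using hδ0)
  obtain ⟨N, hN⟩ := ((ENNReal.tendsto_pow_atTop_nhds_zero_of_lt_one hlt).eventually
    (gt_mem_nhds hε)).exists
  exact ⟨N, fun v hv => ((hpow v).trans (pow_le_pow_right_of_le_one' hlt.le hv)).trans hN.le⟩

theorem len_rpow_eq {K : ℝ} (hE : E.HasBoundedDistortion K) (s : ℝ) (v : List (Fin E.g)) :
    E.len v ^ (s - 1) * E.len v = E.len v ^ s := by
  conv_lhs => rw [← ENNReal.rpow_one (E.len v), ← ENNReal.rpow_mul, one_mul]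
  rw [← ENNReal.rpow_add _ _ (len_ne_zero hE v) (len_ne_top v), sub_add_cancel]

theorem measure_Ico_le_of_forall_cylinder {K : ℝ} (hK : 1 ≤ K) (hE : E.HasBoundedDistortion K)
    {s : ℝ} (hs : 0 < s) (hs1 : s < 1) {δ : ℝ} (hδ0 : 0 < δ)
    (hδ : ∀ v i, ENNReal.ofReal δ * E.len v ≤ E.len (v ++ [i]))
    (ν : Measure ℝ) (hν : ν (Ico 0 1)ᶜ = 0) {A : ℝ≥0∞} (hA : ∀ v, ν (E.cylinder v) ≤ A * E.len v ^ s)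
    {x y : ℝ} (hxy : x < y) :
    ν (Ico x y) ≤ A * (ENNReal.ofReal δ ^ (s - 1) * 3) * ENNReal.ofReal (y - x) ^ s := by
  have hr : 0 < y - x := sub_pos.2 hxy
  set r := y - x with hrdef
  set R := ENNReal.ofReal r with hR
  have hR0 : R ≠ 0 := by simpa [hR] using hr
  have hRt : R ≠ ∞ := ENNReal.ofReal_ne_top
  set d := ENNReal.ofReal δ with hd
  have hd0 : d ≠ 0 := by simpa [hd] using hδ0
  set M := A * (d * R) ^ (s - 1) with hM
  set J := Ico (x - r) (y + r) with hJ
  have small : ∀ v, d * R ≤ E.len v → E.len v ≤ R →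
      ν (Ico x y ∩ E.cylinder v) ≤ M * volume (J ∩ E.cylinder v) := by
    intro v h1 h2
    by_cases h : (Ico x y ∩ E.cylinder v).Nonempty
    · obtain ⟨z, hz, hzv⟩ := h
      have hsub : E.cylinder v ⊆ J := by
        intro u hu
        have h3 := (edist_le_volume_of_ordConnected (ordConnected_cylinder v) hu hzv).trans h2
        rw [edist_dist, hR, ENNReal.ofReal_le_ofReal_iff hr.le, Real.dist_eq, abs_le] at h3
        exact ⟨by linarith [hz.1], by linarith [hz.2]⟩
      rw [inter_eq_right.2 hsub]
      calc ν (Ico x y ∩ E.cylinder v) ≤ A * E.len v ^ s :=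
            (measure_mono inter_subset_right).trans (hA v)
        _ = A * (E.len v ^ (s - 1) * E.len v) := by rw [len_rpow_eq hE]
        _ ≤ A * ((d * R) ^ (s - 1) * E.len v) :=
            mul_le_mul' le_rfl
              (mul_le_mul' (ENNReal.rpow_le_rpow_of_exponent_nonpos h1 (sub_nonpos.2 hs1.le)) le_rfl)
        _ = _ := by rw [hM, ← mul_assoc]; rfl
    · rw [not_nonempty_iff_eq_empty.1 h, measure_empty]
      exact zero_le
  obtain ⟨N, hN⟩ := exists_len_le hK hE (pos_iff_ne_zero.2 hR0)
  have main : ∀ k v, N ≤ v.length + k → d * R ≤ E.len v →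
      ν (Ico x y ∩ E.cylinder v) ≤ M * volume (J ∩ E.cylinder v) := by
    intro k
    induction k with
    | zero => exact fun v hv h => small v h (hN v (by simpa using hv))
    | succ k ih =>
      intro v hv h
      rcases le_total (E.len v) R with h2 | h2
      · exact small v h h2
      · have hvol : volume (J ∩ E.cylinder v) = ∑ i, volume (J ∩ E.cylinder (v ++ [i])) := by
          rw [← iUnion_cylinder_append v, inter_iUnion, measure_iUnion, tsum_fintype]
          · exact fun i j hij => (pairwise_disjoint_cylinder_append v hij).mono
              inter_subset_right inter_subset_right
          · exact fun i => measurableSet_Ico.inter (measurableSet_cylinder _)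
        rw [hvol, Finset.mul_sum]
        calc ν (Ico x y ∩ E.cylinder v) = ν (⋃ i, Ico x y ∩ E.cylinder (v ++ [i])) := by
              rw [← inter_iUnion, iUnion_cylinder_append]
          _ ≤ ∑ i, ν (Ico x y ∩ E.cylinder (v ++ [i])) := measure_iUnion_fintype_le _ _
          _ ≤ _ := by
              refine Finset.sum_le_sum fun i _ => ih _ ?_ ?_
              · rw [List.length_append, List.length_singleton]; omega
              · exact le_trans (by gcongr) (hδ v i)
  have hR1 : ν (Ico x y) ≤ ν (Ico x y ∩ E.cylinder []) := by
    rw [cylinder_nil]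
    calc ν (Ico x y) ≤ ν (Ico x y ∩ Ico 0 1) + ν (Ico x y \ Ico 0 1) :=
          measure_le_inter_add_sdiff _ _ _
      _ ≤ ν (Ico x y ∩ Ico 0 1) + 0 := by
          gcongr
          exact (measure_mono fun z hz => hz.2).trans hν.le
      _ = _ := add_zero _
  have hvolJ : volume J = 3 * R := by
    rw [hJ, Real.volume_Ico, show y + r - (x - r) = 3 * r by rw [hrdef]; ring,
      ENNReal.ofReal_mul (by norm_num)]
    simp [hR]
  by_cases hbig : d * R ≤ E.len []
  · calc ν (Ico x y) ≤ M * volume (J ∩ E.cylinder []) :=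
          hR1.trans (main N [] (by simp) hbig)
      _ ≤ M * (3 * R) := by
          gcongr
          rw [← hvolJ]
          exact measure_mono inter_subset_left
      _ = A * (d ^ (s - 1) * 3) * (R ^ (s - 1) * R) := by
          rw [hM, ENNReal.mul_rpow_of_ne_top (by simp [hd]) hRt]; ring
      _ = _ := by
          conv_lhs => rw [← ENNReal.rpow_one R, ← ENNReal.rpow_mul, one_mul]
          rw [← ENNReal.rpow_add _ _ hR0 hRt, sub_add_cancel]
  · have hd1 : d ≤ 1 := by
      have h1 := (hδ [] E.zeroSym).trans (len_le_one _)
      rwa [show E.len [] = 1 by simp [len, cylinder_nil], mul_one] at h1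
    have hR1' : 1 ≤ R := by
      rw [show E.len [] = 1 by simp [len, cylinder_nil]] at hbig
      exact (not_le.1 hbig).le.trans (mul_le_of_le_one_left zero_le hd1)
    have h1 : 1 ≤ d ^ (s - 1) := ENNReal.one_le_rpow_of_pos_of_le_one_of_neg
      (pos_iff_ne_zero.2 hd0) hd1 (by linarith)
    have h2 : 1 ≤ R ^ s := by
      simpa using ENNReal.rpow_le_rpow hR1' hs.le
    calc ν (Ico x y) ≤ A * E.len [] ^ s :=
          hR1.trans ((measure_mono inter_subset_right).trans (hA []))
      _ ≤ A * (1 * 1) * 1 := by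
          rw [mul_one, mul_one]
          gcongr
          exact ENNReal.rpow_le_one (len_le_one _) hs.le
      _ ≤ _ := by
          gcongr
          norm_num

/-- The outer measure given by covers by cylinders, weighted by the `s`-th power of length. -/
def content (E : ExpandingFullShift) (s : ℝ) : OuterMeasure ℝ :=
  OuterMeasure.boundedBy fun A => ⨅ (v : List (Fin E.g)) (_ : A ⊆ E.cylinder v), E.len v ^ s

theorem content_le {s : ℝ} {A : Set ℝ} {v : List (Fin E.g)} (h : A ⊆ E.cylinder v) :
    E.content s A ≤ E.len v ^ s :=
  (OuterMeasure.boundedBy_le A).trans (iInf₂_le v h)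

theorem content_ne_zero {s : ℝ} (hs : 0 < s) {A : Set ℝ} (h : μH[s] A ≠ 0) :
    E.content s A ≠ 0 := by
  contrapose! h
  refine hausdorffMeasure_eq_zero_of_forall_cover hs fun η hη => ?_
  have h1 := h.trans_lt hη
  rw [content, OuterMeasure.boundedBy_apply] at h1
  simp only [iInf_lt_iff] at h1
  obtain ⟨t, ht, hlt⟩ := h1
  refine ⟨t, ht, (ENNReal.tsum_le_tsum fun n => ?_).trans_lt hlt⟩
  rcases (t n).eq_empty_or_nonempty with h0 | h0
  · simp [h0, hs]
  · rw [iSup_pos h0]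
    refine le_iInf₂ fun v hv => ENNReal.rpow_le_rpow ?_ hs.le
    exact (Metric.ediam_mono hv).trans (ediam_le_volume_of_ordConnected (ordConnected_cylinder v))

theorem mul_content_le {K : ℝ} (hK : 1 ≤ K) (hE : E.HasBoundedDistortion K) {s : ℝ} (hs : 0 < s)
    {T : Set ℝ} (hT : T ⊆ Ico 0 1) (u : List (Fin E.g)) :
    E.len u ^ s / ENNReal.ofReal K ^ s * E.content s T ≤
      E.content s (E.cylinder u ∩ E.f^[u.length] ⁻¹' T) := by
  set c := E.len u ^ s / ENNReal.ofReal K ^ s with hc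
  have hK1 : 1 ≤ ENNReal.ofReal K := by simpa using hK
  have hKs0 : ENNReal.ofReal K ^ s ≠ 0 :=
    (ENNReal.rpow_pos (zero_lt_one.trans_le hK1) ENNReal.ofReal_ne_top).ne'
  have hKst : ENNReal.ofReal K ^ s ≠ ∞ := ENNReal.rpow_ne_top_of_nonneg hs.le ENNReal.ofReal_ne_top
  have hcu : c ≤ E.len u ^ s := by
    refine ENNReal.div_le_of_le_mul (le_mul_of_one_le_right zero_le ?_)
    exact ENNReal.one_le_rpow hK1 hs
  set lam : OuterMeasure ℝ := c • OuterMeasure.restrict (E.cylinder u)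
    (OuterMeasure.comap (E.f^[u.length]) (E.content s)) with hlam
  have hlam_apply : ∀ A, lam A = c * E.content s (E.f^[u.length] '' (A ∩ E.cylinder u)) := by
    intro A
    rw [hlam, FunLike.coe_smul, Pi.smul_apply, OuterMeasure.restrict_apply,
      OuterMeasure.comap_apply, smul_eq_mul]
  have hle : lam ≤ E.content s := by
    refine OuterMeasure.le_boundedBy.2 fun A => le_iInf₂ fun v hv => ?_
    rw [hlam_apply]
    rcases prefix_or_prefix_or_disjoint u v with h | h | h
    · obtain ⟨t, rfl⟩ := h
      have himg : E.f^[u.length] '' (A ∩ E.cylinder u) ⊆ E.cylinder t := by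
        rintro _ ⟨z, ⟨hz, -⟩, rfl⟩
        exact (mem_cylinder_append.1 (hv hz)).2
      calc c * E.content s (E.f^[u.length] '' (A ∩ E.cylinder u)) ≤ c * E.len t ^ s := by
            gcongr; exact content_le himg
        _ = (E.len u * E.len t) ^ s / ENNReal.ofReal K ^ s := by
            rw [hc, ENNReal.mul_rpow_of_nonneg _ _ hs.le, ENNReal.mul_div_right_comm]
        _ ≤ E.len (u ++ t) ^ s := by
            refine ENNReal.div_le_of_le_mul' ?_
            rw [← ENNReal.mul_rpow_of_nonneg _ _ hs.le]
            exact ENNReal.rpow_le_rpow (hE u t).2 hs.le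
    · have himg : E.f^[u.length] '' (A ∩ E.cylinder u) ⊆ E.cylinder [] := by
        rintro _ ⟨z, ⟨-, hz⟩, rfl⟩
        rw [cylinder_nil]
        exact ((mem_cylinder_append (v := [])).1 (by simpa using hz)).2.1
      calc c * E.content s (E.f^[u.length] '' (A ∩ E.cylinder u)) ≤ c * 1 := by
            gcongr
            exact (content_le himg).trans (ENNReal.rpow_le_one (len_le_one _) hs.le)
        _ ≤ E.len u ^ s := by rwa [mul_one]
        _ ≤ E.len v ^ s := ENNReal.rpow_le_rpow (len_anti h) hs.le
    · have : A ∩ E.cylinder u = ∅ := by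
        rw [← disjoint_iff_inter_eq_empty]
        exact h.symm.mono_left hv
      rw [this]
      simp
  refine le_trans ?_ (hle _)
  rw [hlam_apply]
  gcongr
  intro y hy
  obtain ⟨x, hx, rfl⟩ := exists_iterate_eq u (hT hy)
  exact ⟨x, ⟨⟨hx, hy⟩, hx⟩, rfl⟩

theorem exists_frostman_measure {K : ℝ} (hE : E.HasBoundedDistortion K)
    {s : ℝ} (hs : 0 < s) (hs1 : s < 1) (T : Set ℝ) (k : ℕ) (v : List (Fin E.g)) :
    ∃ (ν : Measure ℝ) (D : ℝ≥0∞), D ≠ ∞ ∧ ν ≤ D • volume ∧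
      ν (⋃ w ∈ {w : List (Fin E.g) | w.length = v.length + k ∧ (E.cylinder w ∩ T).Nonempty},
        interior (E.cylinder w))ᶜ = 0 ∧
      ν (E.cylinder v)ᶜ = 0 ∧ (∀ u, ν (E.cylinder u) ≤ E.len u ^ s) ∧
      E.content s (E.cylinder v ∩ T) ≤ ν univ := by
  induction k generalizing v with
  | zero =>
    by_cases h : (E.cylinder v ∩ T).Nonempty
    · have huniv : (E.len v ^ (s - 1) • volume.restrict (interior (E.cylinder v))) univ =
          E.len v ^ s := by
        rw [Measure.smul_apply, Measure.restrict_apply_univ, volume_interior_cylinder,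
          smul_eq_mul, len_rpow_eq hE]
      have hzero : ∀ B, interior (E.cylinder v) ⊆ B →
          (E.len v ^ (s - 1) • volume.restrict (interior (E.cylinder v))) Bᶜ = 0 := by
        intro B hB
        refine measure_mono_null (compl_subset_compl.2 hB) ?_
        rw [Measure.smul_apply, Measure.restrict_apply isOpen_interior.measurableSet.compl,
          compl_inter_self, measure_empty, smul_zero]
      refine ⟨E.len v ^ (s - 1) • volume.restrict (interior (E.cylinder v)), E.len v ^ (s - 1),
        ENNReal.rpow_ne_top_of_ne_zero (len_ne_zero hE v) (len_ne_top v), ?_,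
        hzero _ (subset_biUnion_of_mem (u := fun w => interior (E.cylinder w)) ⟨by simp, h⟩),
        hzero _ interior_subset, fun u => ?_, ?_⟩
      · gcongr
        exact Measure.restrict_le_self
      · rcases prefix_or_prefix_or_disjoint v u with h | h | h
        · calc (E.len v ^ (s - 1) • volume.restrict (interior (E.cylinder v))) (E.cylinder u)
              ≤ E.len v ^ (s - 1) * E.len u := by
                rw [Measure.smul_apply, smul_eq_mul]
                gcongr
                exact Measure.restrict_apply_le _ _
            _ ≤ E.len u ^ (s - 1) * E.len u :=
                mul_le_mul' (ENNReal.rpow_le_rpow_of_exponent_nonpos (len_anti h) (sub_nonpos.2 hs1.le)) le_rfl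
            _ = _ := len_rpow_eq hE s u
        · refine (measure_mono (subset_univ _)).trans (huniv.le.trans ?_)
          exact ENNReal.rpow_le_rpow (len_anti h) hs.le
        · refine (measure_mono_null ?_ (hzero _ interior_subset)).trans_le zero_le
          exact fun z hz hz' => disjoint_left.1 h hz' hz
      · rw [huniv]
        exact content_le inter_subset_left
    · refine ⟨0, 0, by simp, by simp, by simp, by simp, by simp, ?_⟩
      rw [not_nonempty_iff_eq_empty.1 h]
      simp
  | succ k ih =>
    choose ν D hD hνD hνc hνv hνu hνT using fun i => ih (v ++ [i])
    let σ : Measure ℝ := ∑ i, ν i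
    have hσ : ∀ A, σ A = ∑ i, ν i A := fun A => by simp [σ, Measure.finsetSum_apply]
    have hνfin : ∀ i, ν i univ ≠ ∞ := fun i => by
      have h1 : ν i univ ≤ ν i (E.cylinder (v ++ [i])) := by
        calc ν i univ ≤ ν i (E.cylinder (v ++ [i])) + ν i (E.cylinder (v ++ [i]))ᶜ := by
              conv_lhs => rw [← union_compl_self (E.cylinder (v ++ [i]))]
              exact measure_union_le _ _
          _ = _ := by rw [hνv, add_zero]
      refine ((h1.trans (hνu i _)).trans_lt ?_).ne
      exact (ENNReal.rpow_ne_top_of_nonneg hs.le (len_ne_top _)).lt_top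
    have hσfin : σ univ ≠ ∞ := by
      rw [hσ]; exact ENNReal.sum_ne_top.2 fun i _ => hνfin i
    set θ : ℝ≥0∞ := min 1 (E.len v ^ s / σ univ) with hθ
    have hθ1 : θ ≤ 1 := min_le_left _ _
    have hθv : θ * σ univ ≤ E.len v ^ s := ENNReal.mul_le_of_le_div (min_le_right _ _)
    have hap : ∀ A, (θ • σ) A = θ * σ A := fun A => by rw [Measure.smul_apply, smul_eq_mul]
    have hσle : ∀ A, (θ • σ) A ≤ σ A := fun A => by
      rw [hap]; exact mul_le_of_le_one_left zero_le hθ1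
    have hσv : σ (E.cylinder v)ᶜ = 0 := by
      rw [hσ]
      refine Finset.sum_eq_zero fun i _ => measure_mono_null (compl_subset_compl.2 ?_) (hνv i)
      exact cylinder_anti (List.prefix_append _ _)
    refine ⟨θ • σ, ∑ i, D i, ENNReal.sum_ne_top.2 fun i _ => hD i, ?_, ?_, ?_, fun u => ?_, ?_⟩
    · refine Measure.le_iff'.2 fun A => (hσle A).trans ?_
      rw [hσ, Measure.smul_apply, smul_eq_mul, Finset.sum_mul]
      exact Finset.sum_le_sum fun i _ => by simpa using hνD i A
    · refine le_antisymm ((hσle _).trans ?_) zero_le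
      rw [hσ]
      refine (Finset.sum_eq_zero fun i _ => measure_mono_null (compl_subset_compl.2 ?_)
        (hνc i)).le
      refine biUnion_subset_biUnion_left fun w hw => ⟨?_, hw.2⟩
      rw [hw.1, List.length_append, List.length_singleton]
      omega
    · exact le_antisymm ((hσle _).trans hσv.le) zero_le
    · rcases prefix_or_prefix_or_disjoint v u with h | h | h
      · obtain ⟨t, rfl⟩ := h
        cases t with
        | nil =>
          rw [List.append_nil]
          exact (measure_mono (subset_univ _)).trans ((hap _).trans_le hθv)
        | cons i t =>
          refine (hσle _).trans ?_
          rw [hσ, Finset.sum_eq_single i]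
          · exact hνu i _
          · intro j _ hji
            refine measure_mono_null ?_ (hνv j)
            intro z hz hz'
            refine disjoint_left.1 (pairwise_disjoint_cylinder_append v hji) hz' ?_
            exact cylinder_anti (u := v ++ [i]) ⟨t, by simp⟩ hz
          · simp
      · refine (measure_mono (subset_univ _)).trans (((hap _).trans_le hθv).trans ?_)
        exact ENNReal.rpow_le_rpow (len_anti h) hs.le
      · refine ((hσle _).trans ?_).trans zero_le
        refine (measure_mono_null ?_ hσv).le
        exact fun z hz hz' => disjoint_left.1 h hz' hz
    · rw [hap]
      rcases le_total 1 (E.len v ^ s / σ univ) with h | h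
      · rw [hθ, min_eq_left h, one_mul, hσ]
        calc E.content s (E.cylinder v ∩ T)
            = E.content s (⋃ i, E.cylinder (v ++ [i]) ∩ T) := by
              rw [← iUnion_inter, iUnion_cylinder_append]
          _ ≤ ∑ i, E.content s (E.cylinder (v ++ [i]) ∩ T) := measure_iUnion_fintype_le _ _
          _ ≤ _ := Finset.sum_le_sum fun i _ => hνT i
      · rw [hθ, min_eq_right h]
        refine (content_le inter_subset_left).trans ?_
        rcases eq_or_ne (σ univ) 0 with h0 | h0
        · rw [h0, ENNReal.div_zero] at h
          · simp at h
          · exact (ENNReal.rpow_pos (pos_iff_ne_zero.2 (len_ne_zero hE v)) (len_ne_top v)).ne'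
        · rw [ENNReal.div_mul_cancel h0 hσfin]

theorem iterate_mem_branch_iff {v : List (Fin E.g)} {x : ℝ} (hx : x ∈ E.cylinder v) {k : ℕ}
    (hk : k < v.length) (j : Fin E.g) : E.f^[k] x ∈ E.branch j ↔ v.get ⟨k, hk⟩ = j :=
  ⟨fun h => disjoint_branch (hx.2 k hk) h, fun h => h ▸ hx.2 k hk⟩

theorem freq_eq_of_mem_cylinder {m : ℕ} (w : Fin m → Fin E.g) {v : List (Fin E.g)} {x y : ℝ}
    (hx : x ∈ E.cylinder v) (hy : y ∈ E.cylinder v) :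
    E.freq w x v.length = E.freq w y v.length := by
  unfold freq
  congr 3
  refine Finset.filter_congr fun i hi => forall_congr' fun k => ?_
  have hk : i + (k : ℕ) < v.length := by
    have := Finset.mem_range.1 hi
    omega
  rw [iterate_mem_branch_iff hx hk, iterate_mem_branch_iff hy hk]

theorem abs_freq_sub_freq_le {m : ℕ} (w : Fin m → Fin E.g) (x : ℝ) (l : ℕ) {n : ℕ} (hn : m < n) :
    |E.freq w x (n + l) - E.freq w (E.f^[l] x) n| ≤ l / ((n - m : ℕ) : ℝ) := by
  obtain ⟨d, rfl⟩ := Nat.exists_eq_add_of_lt hn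
  have e1 : m + d + 1 - m = d + 1 := by omega
  have e2 : m + d + 1 + l - m = l + (d + 1) := by omega
  set P : ℕ → Prop := fun i => ∀ k : Fin m, E.f^[i + k] x ∈ E.branch (w k) with hP
  have hshift : ∀ i, (∀ k : Fin m, E.f^[i + k] (E.f^[l] x) ∈ E.branch (w k)) ↔ P (l + i) := by
    intro i
    refine forall_congr' fun k => ?_
    rw [← Function.iterate_add_apply, show i + (k : ℕ) + l = l + i + k by ring]
  set c := ((Finset.range (d + 1)).filter fun i => P (l + i)).card with hc
  set e := ((Finset.range l).filter P).card with he
  have hsplit : ((Finset.range (l + (d + 1))).filter P).card = e + c := by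
    rw [hc, he, Finset.card_filter, Finset.card_filter, Finset.card_filter, Finset.sum_range_add]
  have hcle : (c : ℝ) ≤ d + 1 := by
    exact_mod_cast (Finset.card_filter_le _ _).trans (Finset.card_range (d + 1)).le
  have hele : (e : ℝ) ≤ l := by
    exact_mod_cast (Finset.card_filter_le _ _).trans (Finset.card_range l).le
  have h1 : E.freq w x (m + d + 1 + l) = ((e : ℝ) + c) / (l + (d + 1)) := by
    unfold freq
    rw [e2, hsplit]
    push_cast
    rfl
  have h2 : E.freq w (E.f^[l] x) (m + d + 1) = (c : ℝ) / (d + 1) := by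
    unfold freq
    rw [e1, Finset.filter_congr fun i _ => hshift i, ← hc]
    push_cast
    rfl
  rw [h1, h2, e1]
  push_cast
  have hc0 : (0 : ℝ) ≤ c := Nat.cast_nonneg _
  have he0 : (0 : ℝ) ≤ e := Nat.cast_nonneg _
  have hl0 : (0 : ℝ) ≤ l := Nat.cast_nonneg _
  have hd0 : (0 : ℝ) < (d : ℝ) + 1 := by positivity
  have hld : (0 : ℝ) < (l : ℝ) + (d + 1) := by positivity
  rw [div_sub_div _ _ hld.ne' hd0.ne', abs_div, abs_of_pos (mul_pos hld hd0),
    div_le_div_iff₀ (mul_pos hld hd0) hd0, ← mul_assoc]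
  refine mul_le_mul_of_nonneg_right ?_ hd0.le
  rw [abs_le]
  constructor
  · nlinarith [mul_le_mul_of_nonneg_left hcle hl0, mul_nonneg he0 hd0.le, mul_nonneg hl0 hl0]
  · nlinarith [mul_le_mul_of_nonneg_right hele hd0.le, mul_nonneg hc0 hl0, mul_nonneg hl0 hl0]

theorem isFat_freq {K : ℝ} (hK : 1 ≤ K) (hE : E.HasBoundedDistortion K) {s : NNReal} (hs : 0 < s)
    (hs1 : s < 1) {m : ℕ} (w : Fin m → Fin E.g) {a : ℝ}
    (hdim : (s : ℝ≥0∞) < dimH {x ∈ Ico (0 : ℝ) 1 | Tendsto (E.freq w x) atTop (nhds a)})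
    (N : ℕ) {ε : ℝ} (hε : 0 < ε) : IsFat s {x | ∃ n, N ≤ n ∧ |E.freq w x n - a| < ε} := by
  have hs' : (0 : ℝ) < s := by exact_mod_cast hs
  have hs1' : (s : ℝ) < 1 := by exact_mod_cast hs1
  set V := {x | ∃ n, N ≤ n ∧ |E.freq w x n - a| < ε} with hV
  let T : ℕ → Set ℝ := fun M => {x ∈ Ico (0 : ℝ) 1 | ∀ n, M ≤ n → |E.freq w x n - a| < ε / 2}
  obtain ⟨M, hM⟩ : ∃ M, (s : ℝ≥0∞) < dimH (T M) := by
    rw [← lt_iSup_iff, ← dimH_iUnion]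
    refine hdim.trans_le (dimH_mono fun x hx => ?_)
    obtain ⟨M, hM⟩ := Metric.tendsto_atTop.1 hx.2 (ε / 2) (by positivity)
    exact mem_iUnion.2 ⟨M, hx.1, fun n hn => by simpa [Real.dist_eq] using hM n hn⟩
  have hκ0 : E.content s (T M) ≠ 0 :=
    content_ne_zero hs' (by rw [hausdorffMeasure_of_lt_dimH hM]; exact ENNReal.top_ne_zero)
  have hTsub : T M ⊆ Ico 0 1 := fun x hx => hx.1
  set κ := E.content s (T M) with hκ
  have hκt : κ ≠ ∞ := by
    have h1 : κ ≤ E.len [] ^ (s : ℝ) := content_le (by rwa [cylinder_nil])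
    exact (h1.trans_lt (ENNReal.rpow_lt_top_of_nonneg hs'.le (len_ne_top _))).ne
  obtain ⟨δ, hδ0, hδ⟩ := exists_mul_len_le hK hE
  set Q := ENNReal.ofReal K ^ (s : ℝ) with hQ
  have hQ0 : Q ≠ 0 := (ENNReal.rpow_pos (by simp; linarith) ENNReal.ofReal_ne_top).ne'
  have hQt : Q ≠ ∞ := ENNReal.rpow_ne_top_of_nonneg hs'.le ENNReal.ofReal_ne_top
  set G := ENNReal.ofReal δ ^ ((s : ℝ) - 1) * 3 with hG
  have hGt : G ≠ ∞ := ENNReal.mul_ne_top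
    (ENNReal.rpow_ne_top_of_ne_zero (by simpa using hδ0) ENNReal.ofReal_ne_top) (by simp)
  refine ⟨Q / κ * G, ENNReal.mul_ne_top (ENNReal.div_ne_top hQt hκ0) hGt, fun η hη => ?_⟩
  obtain ⟨l, hl⟩ := exists_len_le hK hE hη
  refine ⟨Fin l → Fin E.g, inferInstance, fun u => E.cylinder (List.ofFn u),
    fun u => ordConnected_cylinder _, ?_, ?_,
    fun u => ⟨hl _ (by simp), len_ne_zero hE _⟩, fun u' => ?_⟩
  · refine fun u v huv => disjoint_left.2 fun x hu hv => huv ?_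
    exact List.ofFn_injective
      ((prefix_of_mem_of_mem hu hv (by simp)).eq_of_length (by simp))
  · refine Subset.antisymm (iUnion_subset fun u => cylinder_subset _) fun x hx => ?_
    exact mem_iUnion.2 (exists_mem_cylinder_ofFn l hx)
  set u := List.ofFn u' with hu
  have hul : u.length = l := by simp [hu]
  obtain ⟨n, hnm, hnM, hnN, hnε⟩ :
      ∃ n, m < n ∧ M ≤ n ∧ N ≤ n ∧ (l : ℝ) / ((n - m : ℕ) : ℝ) < ε / 2 := by
    have h1 : Tendsto (fun n : ℕ => (l : ℝ) / ((n - m : ℕ) : ℝ)) atTop (nhds 0) :=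
      tendsto_const_nhds.div_atTop (tendsto_natCast_atTop_atTop.comp (tendsto_sub_atTop_nat m))
    exact ((eventually_gt_atTop m).and ((eventually_ge_atTop M).and ((eventually_ge_atTop N).and
      (h1.eventually (gt_mem_nhds (by positivity)))))).exists
  set S := E.cylinder u ∩ E.f^[u.length] ⁻¹' T M with hS
  obtain ⟨ν, D, hD, hνD, hνc, hν0, hνu, hνS⟩ :=
    exists_frostman_measure hE hs' hs1' S (n + l) []
  rw [cylinder_nil] at hν0 hνS
  rw [inter_eq_right.2 (inter_subset_left.trans (cylinder_subset u))] at hνS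
  have hmass : E.len u ^ (s : ℝ) / Q * κ ≤ ν univ := (mul_content_le hK hE hs' hTsub u).trans hνS
  have hlu0 := len_ne_zero hE u
  have hlut := len_ne_top u
  have hν_pos : ν univ ≠ 0 := by
    refine ((pos_iff_ne_zero.2 ?_).trans_le hmass).ne'
    exact mul_ne_zero (ENNReal.div_pos (ENNReal.rpow_pos (pos_iff_ne_zero.2 hlu0) hlut).ne' hQt).ne'
      hκ0
  have hν_fin : ν univ ≠ ∞ := by
    have h1 : ν univ ≤ ν (E.cylinder []) := by
      calc ν univ ≤ ν (Ico 0 1) + ν (Ico 0 1)ᶜ := by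
            conv_lhs => rw [← union_compl_self (Ico (0 : ℝ) 1)]
            exact measure_union_le _ _
        _ = _ := by rw [hν0, add_zero, cylinder_nil]
    exact ((h1.trans (hνu [])).trans_lt
      (ENNReal.rpow_lt_top_of_nonneg hs'.le (len_ne_top _))).ne
  set c := E.len u / ν univ with hc
  have hct : c ≠ ∞ := ENNReal.div_ne_top hlut hν_pos
  have hcle : c ≤ Q / κ * E.len u ^ (1 - (s : ℝ)) := by
    refine ENNReal.div_le_of_le_mul ?_
    calc E.len u = E.len u ^ (1 - (s : ℝ)) * E.len u ^ (s : ℝ) := by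
          rw [← ENNReal.rpow_add _ _ hlu0 hlut, sub_add_cancel, ENNReal.rpow_one]
      _ = (Q * Q⁻¹) * (κ * κ⁻¹) * (E.len u ^ (1 - (s : ℝ)) * E.len u ^ (s : ℝ)) := by
          rw [ENNReal.mul_inv_cancel hQ0 hQt, ENNReal.mul_inv_cancel hκ0 hκt, one_mul, one_mul]
      _ = Q / κ * E.len u ^ (1 - (s : ℝ)) * (E.len u ^ (s : ℝ) / Q * κ) := by
          rw [div_eq_mul_inv, div_eq_mul_inv]; ring
      _ ≤ _ := by gcongr
  refine ⟨c • ν, c * D, ENNReal.mul_ne_top hct hD, ?_, ?_, ?_, fun x y => ?_⟩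
  · rw [← smul_smul]
    gcongr
  · rw [Measure.smul_apply, measure_mono_null (compl_subset_compl.2 ?_) hνc, smul_zero]
    refine iUnion₂_subset fun v hv => ?_
    obtain ⟨hvl, x, hxv, hxu, hxT⟩ := hv
    rw [List.length_nil, zero_add] at hvl
    have huv : u <+: v := prefix_of_mem_of_mem hxu hxv (by omega)
    refine subset_inter (interior_mono fun y hy => ⟨n + l, by omega, ?_⟩)
      (interior_subset.trans (cylinder_anti huv))
    have h1 : E.freq w y (n + l) = E.freq w x (n + l) := by
      rw [← hvl]; exact freq_eq_of_mem_cylinder w hy hxv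
    have h2 := abs_freq_sub_freq_le w x l hnm
    have h3 := hxT.2 n hnM
    rw [hul] at h3
    rw [h1]
    calc |E.freq w x (n + l) - a| ≤ |E.freq w x (n + l) - E.freq w (E.f^[l] x) n| +
          |E.freq w (E.f^[l] x) n - a| := abs_sub_le _ _ _
      _ < ε / 2 + ε / 2 := add_lt_add (h2.trans_lt hnε) h3
      _ = ε := add_halves ε
  · rw [Measure.smul_apply, smul_eq_mul]
    exact ENNReal.div_mul_cancel hν_pos hν_fin
  · rcases le_or_gt y x with hxy | hxy
    · simp [Ico_eq_empty (not_lt.2 hxy)]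
    · refine (measure_Ico_le_of_forall_cylinder hK hE hs' hs1' hδ0 hδ (c • ν) ?_ (A := c)
        (fun v => ?_) hxy).trans ?_
      · rw [Measure.smul_apply, hν0, smul_zero]
      · rw [Measure.smul_apply, smul_eq_mul]
        gcongr
        exact hνu v
      · refine mul_le_mul' ?_ le_rfl
        calc c * G ≤ Q / κ * E.len u ^ (1 - (s : ℝ)) * G := by gcongr
          _ = Q / κ * G * E.len u ^ (1 - (s : ℝ)) := by ring

end ExpandingFullShift

theorem eq_of_forall_frequently_near {u : ℕ → ℝ} {a L : ℝ} (hu : Tendsto u atTop (nhds L))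
    (h : ∀ N : ℕ, ∃ n, N ≤ n ∧ |u n - a| < 1 / ((N : ℝ) + 1)) : L = a := by
  choose n hn hna using h
  have h1 : Tendsto (fun N => u (n N)) atTop (nhds L) :=
    hu.comp (tendsto_atTop_mono hn tendsto_id)
  have h2 : Tendsto (fun N => u (n N)) atTop (nhds a) := by
    refine tendsto_iff_dist_tendsto_zero.2 (squeeze_zero (fun _ => dist_nonneg)
      (fun N => (hna N).le) tendsto_one_div_add_atTop_nhds_zero_nat)
  exact tendsto_nhds_unique h1 h2

theorem le_dimH_no_converging_frequency {s : NNReal} (hs : 0 < s) (hs1 : s < 1)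
    (E : ℕ → ExpandingFullShift)
    (hbd : ∀ i, ∃ K : ℝ, 1 ≤ K ∧ (E i).HasBoundedDistortion K)
    (hii : ∀ i, (E i).CondII) :
    (s : ℝ≥0∞) ≤ dimH {x ∈ Ico (0:ℝ) 1 | ∀ i, ∀ m : ℕ, 0 < m → ∀ w : Fin m → Fin (E i).g,
      ¬ ∃ L : ℝ, Tendsto (fun n => (E i).freq w x n) atTop (nhds L)} := by
  obtain ⟨t, hst, ht1⟩ := ENNReal.lt_iff_exists_nnreal_btwn.1
    (show (s : ℝ≥0∞) < 1 by exact_mod_cast hs1)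
  choose p _ hp1 hp using fun i m => hii i (m + 1) m.succ_pos
  choose q _ hqne hq using fun i m w => hp i m w t ht1
  let ι := Σ i, Σ m, (Fin (m + 1) → Fin (E i).g) × ℕ × Bool
  let lim : ι → ℝ := fun j => if j.2.2.2.2 then p j.1 j.2.1 j.2.2.1 else
    q j.1 j.2.1 j.2.2.1 j.2.2.1
  let V : ι → Set ℝ := fun j => {x | ∃ n, j.2.2.2.1 ≤ n ∧
    |(E j.1).freq j.2.2.1 x n - lim j| < 1 / ((j.2.2.2.1 : ℝ) + 1)}
  have hV : ∀ j, IsFat s (V j) := by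
    rintro ⟨i, m, w, N, b⟩
    obtain ⟨K, hK, hE⟩ := hbd i
    refine ExpandingFullShift.isFat_freq hK hE hs hs1 w ?_ N (by positivity)
    cases b with
    | true =>
      refine (ENNReal.coe_lt_coe.2 hs1).trans_le ?_
      rw [ENNReal.coe_one, ← hp1 i m]
      exact dimH_mono fun x hx => ⟨hx.1, hx.2 w⟩
    | false =>
      refine (hst.trans_le (hq i m w)).trans_le ?_
      exact dimH_mono fun x hx => ⟨hx.1, hx.2 w⟩
  have : Nonempty ι := ⟨⟨0, 0, fun _ => (E 0).zeroSym, 0, true⟩⟩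
  obtain ⟨e, he⟩ := exists_surjective_nat ι
  refine (le_dimH_iInter_of_isFat hs hs1 (fun n => V (e n)) fun n => hV _).trans
    (dimH_mono fun x hx => ⟨hx.1, fun i m hm w => ?_⟩)
  have hxV : ∀ j, x ∈ V j := fun j => by
    obtain ⟨n, rfl⟩ := he j
    exact mem_iInter.1 hx.2 n
  obtain ⟨m, rfl⟩ := Nat.exists_eq_succ_of_ne_zero hm.ne'
  rintro ⟨L, hL⟩
  have h1 : L = p i m w := eq_of_forall_frequently_near hL fun N => hxV ⟨i, m, w, N, true⟩
  have h2 : L = q i m w w := eq_of_forall_frequently_near hL fun N => hxV ⟨i, m, w, N, false⟩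
  exact hqne i m w (h2.symm.trans h1)

open ExpandingFullShift in
/-- for a sequence of expanding full-shift maps with bounded distortion
satisfying condition (ii), the set of points for which no word frequency converges,
for any word of any length and any of the maps, has Hausdorff dimension `1`. -/
theorem dimH_no_converging_frequency (E : ℕ → ExpandingFullShift)
    (hbd : ∀ i, ∃ K : ℝ, 1 ≤ K ∧ (E i).HasBoundedDistortion K)
    (hii : ∀ i, (E i).CondII) :
    dimH {x ∈ Ico (0:ℝ) 1 | ∀ i, ∀ m : ℕ, 0 < m → ∀ w : Fin m → Fin (E i).g,
      ¬ ∃ L : ℝ, Tendsto (fun n => (E i).freq w x n) atTop (nhds L)} = 1 := by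
  refine le_antisymm ((dimH_mono (subset_univ _)).trans Real.dimH_univ.le) ?_
  refine le_of_forall_lt fun r hr => ?_
  obtain ⟨s, hrs, hs1⟩ := ENNReal.lt_iff_exists_nnreal_btwn.1 hr
  refine hrs.trans_le (le_dimH_no_converging_frequency ?_ (by exact_mod_cast hs1) E hbd hii)
  exact_mod_cast zero_le.trans_lt hrs
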